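/- Let ω be a radial weight in the class D̂ and let 1<p,q<∞, q'=q/(q−1). If the maximal Bergman projection P_ω^+ is bounded on L^{p,q}_ω, then sup_{1/2 ≤ t < 1} ( ∫_{1/2}^t (1 + J_ω(r))^q · ω(r) dr )^{1/q} · ω̂(t)^{1/q'} < ∞, where J_ω(t) = ∫_0^t ds/(ω̂(s)·(1−s)). -/

import Mathlib

open MeasureTheory Filter Set
open scoped ENNReal

noncomputable section

/-- `ω̂(r) = ∫_r^1 ω(s) ds`. -/
def omegaHat (ω : ℝ → ℝ) (r : ℝ) : ℝ := ∫ s in r..1, ω s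

/-- A radial weight: nonnegative and Lebesgue integrable on `[0,1)`. -/
def IsRadialWeight (ω : ℝ → ℝ) : Prop :=
  (∀ r ∈ Set.Ico (0:ℝ) 1, 0 ≤ ω r) ∧ MeasureTheory.IntegrableOn ω (Set.Ico 0 1)

/-- The class `D̂` of upper doubling radial weights. -/
def InDhat (ω : ℝ → ℝ) : Prop :=
  ∃ C > (0:ℝ), ∀ r ∈ Set.Ico (0:ℝ) 1, omegaHat ω r ≤ C * omegaHat ω ((1 + r) / 2)

/-- The class `Ď`. -/
def InDcheck (ω : ℝ → ℝ) : Prop :=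
  ∃ K > (1:ℝ), ∃ C > (1:ℝ), ∀ r ∈ Set.Ico (0:ℝ) 1,
    C * omegaHat ω (1 - (1 - r) / K) ≤ omegaHat ω r

/-- Moments `μ_x = ∫_0^1 r^x μ(r) dr`. -/
def momentW (μ : ℝ → ℝ) (x : ℝ) : ℝ := ∫ r in (0:ℝ)..1, r ^ x * μ r

/-- The coefficients `μ_{2k+1}` of the `A²_μ` pairing. -/
def momentCoeff (μ : ℝ → ℝ) : ℕ → ℝ := fun k => momentW μ (2 * (k:ℝ) + 1)

/-- The point `r e^{iθ}` of the circle of radius `r`. -/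
def circlePt (r θ : ℝ) : ℂ := (r:ℂ) * Complex.exp ((θ:ℂ) * Complex.I)

/-- Integral means `M_p(r,f)` (with values in `[0,∞]`). -/
def MpE (p r : ℝ) (f : ℂ → ℂ) : ℝ≥0∞ :=
  (ENNReal.ofReal (1 / (2 * Real.pi)) *
    ∫⁻ θ in Set.Ioo (0:ℝ) (2 * Real.pi), ENNReal.ofReal (‖f (circlePt r θ)‖ ^ p)) ^ (1 / p)

/-- Integral means of a `[0,∞]`-valued function. -/
def MpEE (p r : ℝ) (F : ℂ → ℝ≥0∞) : ℝ≥0∞ :=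
  (ENNReal.ofReal (1 / (2 * Real.pi)) *
    ∫⁻ θ in Set.Ioo (0:ℝ) (2 * Real.pi), (F (circlePt r θ)) ^ p) ^ (1 / p)

/-- The norm of the mixed norm space `L^{p,q}_ω`. -/
def LpqNormE (ω : ℝ → ℝ) (p q : ℝ) (f : ℂ → ℂ) : ℝ≥0∞ :=
  (∫⁻ r in Set.Ioo (0:ℝ) 1, (MpE p r f) ^ q * ENNReal.ofReal (r * ω r)) ^ (1 / q)

/-- The `L^{p,q}_ω` norm of a `[0,∞]`-valued function. -/
def LpqNormEE (ω : ℝ → ℝ) (p q : ℝ) (F : ℂ → ℝ≥0∞) : ℝ≥0∞ :=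
  (∫⁻ r in Set.Ioo (0:ℝ) 1, (MpEE p r F) ^ q * ENNReal.ofReal (r * ω r)) ^ (1 / q)

/-- The norm of `A^{p,∞}_ω` : `sup_{0 ≤ r < 1} M_p(r,f) ω̂(r)`. -/
def ApInfNormE (ω : ℝ → ℝ) (p : ℝ) (f : ℂ → ℂ) : ℝ≥0∞ :=
  ⨆ r ∈ Set.Ico (0:ℝ) 1, MpE p r f * ENNReal.ofReal (omegaHat ω r)

/-- Membership in the mixed norm space `A^{p,q}_ω`. -/
def InApq (ω : ℝ → ℝ) (p q : ℝ) (f : ℂ → ℂ) : Prop :=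
  DifferentiableOn ℂ f (Metric.ball 0 1) ∧ LpqNormE ω p q f < ⊤

/-- Membership in `A^{p,∞}_ω`. -/
def InApInf (ω : ℝ → ℝ) (p : ℝ) (f : ℂ → ℂ) : Prop :=
  DifferentiableOn ℂ f (Metric.ball 0 1) ∧ ApInfNormE ω p f < ⊤

/-- Taylor coefficient of `f` at `0`. -/
def taylorCoeff (f : ℂ → ℂ) (n : ℕ) : ℂ := iteratedDeriv n f 0 / (n.factorial : ℂ)

/-- The pairing `⟨f,g⟩ = lim_{r→1⁻} ∑_k f̂(k) conj(ĝ(k)) c(k) r^k` exists and equals `l`. -/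
def HasPairingC (c : ℕ → ℝ) (f g : ℂ → ℂ) (l : ℂ) : Prop :=
  (∀ r ∈ Set.Ico (0:ℝ) 1, Summable (fun k : ℕ =>
    taylorCoeff f k * (starRingEnd ℂ) (taylorCoeff g k) * ((c k : ℝ) : ℂ) * ((r:ℂ)) ^ k)) ∧
  Filter.Tendsto (fun r : ℝ => ∑' k : ℕ,
    taylorCoeff f k * (starRingEnd ℂ) (taylorCoeff g k) * ((c k : ℝ) : ℂ) * ((r:ℂ)) ^ k)
    (nhdsWithin 1 (Set.Iio 1)) (nhds l)

/-- `L` is linear on the functions satisfying `P`. -/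
def IsLinearOn (P : (ℂ → ℂ) → Prop) (L : (ℂ → ℂ) → ℂ) : Prop :=
  (∀ f g : ℂ → ℂ, P f → P g → L (f + g) = L f + L g) ∧
  (∀ (c : ℂ) (f : ℂ → ℂ), P f → L (c • f) = c * L f)

/-- Dilation `f_r(z) = f(rz)`. -/
def dilateF (f : ℂ → ℂ) (r : ℝ) : ℂ → ℂ := fun z => f ((r:ℂ) * z)

/-- The BMOA norm `|f(0)| + sup_{a∈D} sup_{0<r<1} M₂(r, f∘φ_a - f(a))`. -/
def BMOANormE (f : ℂ → ℂ) : ℝ≥0∞ :=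
  ENNReal.ofReal ‖f 0‖ +
    ⨆ a ∈ Metric.ball (0:ℂ) 1, ⨆ r ∈ Set.Ioo (0:ℝ) 1,
      MpE 2 r (fun z => f ((a - z) / (1 - (starRingEnd ℂ) a * z)) - f a)

/-- The Bloch norm `|f(0)| + sup_{z∈D} (1-|z|²)|f'(z)|`. -/
def BlochNormE (f : ℂ → ℂ) : ℝ≥0∞ :=
  ENNReal.ofReal ‖f 0‖ +
    ⨆ z ∈ Metric.ball (0:ℂ) 1, ENNReal.ofReal ((1 - ‖z‖ ^ 2) * ‖deriv f z‖)

/-- The norm of `X(q,ω)`: `(∫_0^1 ‖f_r‖_X^q ω(r) dr)^{1/q}`. -/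
def XqNormE (Xnorm : (ℂ → ℂ) → ℝ≥0∞) (ω : ℝ → ℝ) (q : ℝ) (f : ℂ → ℂ) : ℝ≥0∞ :=
  (∫⁻ r in Set.Ioo (0:ℝ) 1, (Xnorm (dilateF f r)) ^ q * ENNReal.ofReal (ω r)) ^ (1 / q)

/-- The norm of `X(∞,ω)`: `sup_{0<r<1} ‖f_r‖_X ω̂(r)`. -/
def XInfNormE (Xnorm : (ℂ → ℂ) → ℝ≥0∞) (ω : ℝ → ℝ) (f : ℂ → ℂ) : ℝ≥0∞ :=
  ⨆ r ∈ Set.Ioo (0:ℝ) 1, Xnorm (dilateF f r) * ENNReal.ofReal (omegaHat ω r)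

/-- The standard radial weight `ν_β(r) = (β+1)(1-r²)^β`. -/
def nuWeight (β : ℝ) : ℝ → ℝ := fun r => (β + 1) * (1 - r ^ 2) ^ β

/-- The Bergman reproducing kernel `B^ω_a(z) = ∑ (z conj a)^n / (2 ω_{2n+1})`. -/
def bergmanKernel (ω : ℝ → ℝ) (a z : ℂ) : ℂ :=
  ∑' n : ℕ, (z * (starRingEnd ℂ) a) ^ n / (2 * ((momentW ω (2 * (n:ℝ) + 1) : ℝ) : ℂ))

/-- The Bergman projection (`dA` is normalized area measure). -/
def PomegaProj (ω : ℝ → ℝ) (f : ℂ → ℂ) (z : ℂ) : ℂ :=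
  (Real.pi)⁻¹ • ∫ ζ in Metric.ball (0:ℂ) 1,
    f ζ * (starRingEnd ℂ) (bergmanKernel ω z ζ) * ((ω ‖ζ‖ : ℝ) : ℂ)

/-- The maximal Bergman projection applied to `|f|`, with values in `[0,∞]`. -/
def PomegaPlusL (ω : ℝ → ℝ) (f : ℂ → ℂ) (z : ℂ) : ℝ≥0∞ :=
  ∫⁻ ζ in Metric.ball (0:ℂ) 1,
    ENNReal.ofReal (‖f ζ‖ * ‖bergmanKernel ω z ζ‖ * ω ‖ζ‖ / Real.pi)

/-- The Hardy `H¹` norm. -/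
def H1NormE (f : ℂ → ℂ) : ℝ≥0∞ := ⨆ r ∈ Set.Ioo (0:ℝ) 1, MpE 1 r f

/-- `r_n = inf{ r ∈ [0,1) : ω̂(r) = ω̂(0) K^{-n} }`. -/
def rSeq (ω : ℝ → ℝ) (K : ℝ) (n : ℕ) : ℝ :=
  sInf {r | r ∈ Set.Ico (0:ℝ) 1 ∧ omegaHat ω r = omegaHat ω 0 * K ^ (-(n:ℝ))}

/-- `M_n = ⌊1/(1-r_n)⌋`. -/
def MSeq (ω : ℝ → ℝ) (K : ℝ) (n : ℕ) : ℕ := ⌊1 / (1 - rSeq ω K n)⌋₊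

/-- Weighted Hadamard product of a polynomial with an analytic function:
`z ↦ ∑_j c(j) P̂(j) ĝ(j) z^j`. -/
def hadamardPolyC (c : ℕ → ℂ) (P : Polynomial ℂ) (g : ℂ → ℂ) : ℂ → ℂ :=
  fun z => ∑ j ∈ Finset.range (P.natDegree + 1), c j * P.coeff j * taylorCoeff g j * z ^ j

/-- An admissible Banach space of analytic functions on the unit disc, given by a
carrier set and a norm function. -/
structure AdmissibleSpace where
  carrier : Set (ℂ → ℂ)
  nrm : (ℂ → ℂ) → ℝ
  mem_analytic : ∀ f ∈ carrier, DifferentiableOn ℂ f (Metric.ball 0 1)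
  zero_mem : (0 : ℂ → ℂ) ∈ carrier
  add_mem : ∀ f g : ℂ → ℂ, f ∈ carrier → g ∈ carrier → f + g ∈ carrier
  smul_mem : ∀ (c : ℂ) (f : ℂ → ℂ), f ∈ carrier → c • f ∈ carrier
  nrm_nonneg : ∀ f ∈ carrier, 0 ≤ nrm f
  nrm_eq_zero : ∀ f ∈ carrier, nrm f = 0 → ∀ z ∈ Metric.ball (0:ℂ) 1, f z = 0
  nrm_add : ∀ f g : ℂ → ℂ, f ∈ carrier → g ∈ carrier → nrm (f + g) ≤ nrm f + nrm g
  nrm_smul : ∀ (c : ℂ) (f : ℂ → ℂ), f ∈ carrier → nrm (c • f) = ‖c‖ * nrm f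
  complete : ∀ u : ℕ → (ℂ → ℂ), (∀ n, u n ∈ carrier) →
    (∀ ε : ℝ, 0 < ε → ∃ N : ℕ, ∀ m ≥ N, ∀ n ≥ N, nrm (u m - u n) < ε) →
    ∃ f ∈ carrier, Filter.Tendsto (fun n => nrm (u n - f)) Filter.atTop (nhds 0)
  norm_conv_implies_ucc : ∀ (u : ℕ → (ℂ → ℂ)) (f : ℂ → ℂ),
    (∀ n, u n ∈ carrier) → f ∈ carrier →
    Filter.Tendsto (fun n => nrm (u n - f)) Filter.atTop (nhds 0) →
    ∀ Kc : Set ℂ, Kc ⊆ Metric.ball 0 1 → IsCompact Kc →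
      TendstoUniformlyOn (fun n => u n) f Filter.atTop Kc
  ucc_implies_norm_conv : ∀ R : ℝ, 1 < R → ∀ (u : ℕ → (ℂ → ℂ)) (f : ℂ → ℂ),
    (∀ n, u n ∈ carrier ∧ DifferentiableOn ℂ (u n) (Metric.ball 0 R)) →
    DifferentiableOn ℂ f (Metric.ball 0 R) →
    (∀ Kc : Set ℂ, Kc ⊆ Metric.ball (0:ℂ) R → IsCompact Kc →
      TendstoUniformlyOn (fun n => u n) f Filter.atTop Kc) →
    f ∈ carrier ∧ Filter.Tendsto (fun n => nrm (u n - f)) Filter.atTop (nhds 0)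
  dilation_bound : ∃ C > (0:ℝ), ∀ f ∈ carrier, ∀ ζ : ℂ, ‖ζ‖ ≤ 1 →
    (fun z => f (ζ * z)) ∈ carrier ∧ nrm (fun z => f (ζ * z)) ≤ C * nrm f

/-- The operator `T_p = I^{ν_{1/p-2}}`. -/
def TpOp (p : ℝ) (g : ℂ → ℂ) : ℂ → ℂ :=
  fun z => ∑' k : ℕ,
    taylorCoeff g k * ((momentW (nuWeight (1 / p - 2)) (2 * (k:ℝ) + 1) : ℝ) : ℂ) * z ^ k

/-- Membership in the Bloch space. -/
def InBloch (g : ℂ → ℂ) : Prop :=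
  DifferentiableOn ℂ g (Metric.ball 0 1) ∧ BlochNormE g < ⊤

open Classical in
/-- The norm of the space `X_p = T_p(B)`, normed so that `T_p` is an isometry. -/
def XpNormE (p : ℝ) (h : ℂ → ℂ) : ℝ≥0∞ :=
  if H : ∃ g : ℂ → ℂ, InBloch g ∧ Set.EqOn h (TpOp p g) (Metric.ball 0 1)
  then BlochNormE H.choose else ⊤

/-- The polynomial `V_n ∗ g` where `V_n(z) = ∑_{j=2^{n-1}}^{2^{n+1}-1} ψ(j/2^{n-1}) z^j`
and `ψ(t) = Ψ(t/2) - Ψ(t)`. -/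
def VnStar (Ψ : ℝ → ℝ) (n : ℕ) (g : ℂ → ℂ) : ℂ → ℂ :=
  fun z => ∑ j ∈ Finset.Icc (2 ^ (n - 1) : ℕ) (2 ^ (n + 1) - 1 : ℕ),
    (((Ψ ((j:ℝ) / 2 ^ n) - Ψ ((j:ℝ) / 2 ^ (n - 1))) : ℝ) : ℂ) * taylorCoeff g j * z ^ j

/-- `D^ω(V_n ∗ g)`, where `D^ω h(z) = ∑ ĥ(k) z^k/(2ω_{2k+1})`. -/
def DVnStar (Ψ : ℝ → ℝ) (ω : ℝ → ℝ) (n : ℕ) (g : ℂ → ℂ) : ℂ → ℂ :=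
  fun z => ∑ j ∈ Finset.Icc (2 ^ (n - 1) : ℕ) (2 ^ (n + 1) - 1 : ℕ),
    (((Ψ ((j:ℝ) / 2 ^ n) - Ψ ((j:ℝ) / 2 ^ (n - 1))) : ℝ) : ℂ) * taylorCoeff g j * z ^ j /
      (2 * ((momentW ω (2 * (j:ℝ) + 1) : ℝ) : ℂ))

/-- `J_ω(t) = ∫_0^t ds/(ω̂(s)(1-s))`. -/
def Jomega (ω : ℝ → ℝ) (t : ℝ) : ℝ := ∫ s in (0:ℝ)..t, 1 / (omegaHat ω s * (1 - s))

theorem IsRadialWeight.intervalIntegrable {ω : ℝ → ℝ} (hω : IsRadialWeight ω) {a b : ℝ}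
    (ha : 0 ≤ a) (hab : a ≤ b) (hb : b ≤ 1) : IntervalIntegrable ω volume a b := by
  rw [intervalIntegrable_iff_integrableOn_Ico_of_le hab]
  exact hω.2.mono_set (Ico_subset_Ico ha hb)

theorem IsRadialWeight.intervalIntegrable_rpow_mul {ω : ℝ → ℝ} (hω : IsRadialWeight ω)
    {a b x : ℝ} (ha : 0 ≤ a) (hab : a ≤ b) (hb : b ≤ 1) (hx : 0 ≤ x) :
    IntervalIntegrable (fun r => r ^ x * ω r) volume a b :=
  (hω.intervalIntegrable ha hab hb).continuousOn_mul
    ((Real.continuous_rpow_const hx).continuousOn)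

theorem IsRadialWeight.integral_nonneg {ω : ℝ → ℝ} (hω : IsRadialWeight ω) {a b : ℝ}
    {g : ℝ → ℝ} (ha : 0 ≤ a) (hab : a ≤ b) (hb : b ≤ 1)
    (hg : ∀ r ∈ Ico (0:ℝ) 1, 0 ≤ g r) : 0 ≤ ∫ r in a..b, g r * ω r := by
  rw [intervalIntegral.integral_of_le hab, integral_Ioc_eq_integral_Ioo]
  refine setIntegral_nonneg measurableSet_Ioo fun r hr => ?_
  have h : r ∈ Ico (0:ℝ) 1 := ⟨ha.trans hr.1.le, hr.2.trans_le hb⟩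
  exact mul_nonneg (hg r h) (hω.1 r h)

theorem IsRadialWeight.integral_mono {ω : ℝ → ℝ} (hω : IsRadialWeight ω) {a b : ℝ}
    {g h : ℝ → ℝ} (ha : 0 ≤ a) (hab : a ≤ b) (hb : b ≤ 1)
    (hgi : IntervalIntegrable (fun r => g r * ω r) volume a b)
    (hhi : IntervalIntegrable (fun r => h r * ω r) volume a b)
    (hgh : ∀ r ∈ Ioo a b, g r ≤ h r) :
    ∫ r in a..b, g r * ω r ≤ ∫ r in a..b, h r * ω r := by
  refine intervalIntegral.integral_mono_on_of_le_Ioo hab hgi hhi fun r hr => ?_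
  exact mul_le_mul_of_nonneg_right (hgh r hr) (hω.1 r ⟨ha.trans hr.1.le, hr.2.trans_le hb⟩)

theorem IsRadialWeight.omegaHat_antitone {ω : ℝ → ℝ} (hω : IsRadialWeight ω) {a b : ℝ}
    (ha : 0 ≤ a) (hab : a ≤ b) (hb : b ≤ 1) : omegaHat ω b ≤ omegaHat ω a := by
  have h := intervalIntegral.integral_add_adjacent_intervals
    (hω.intervalIntegrable ha hab hb) (hω.intervalIntegrable (ha.trans hab) hb le_rfl)
  have h0 := hω.integral_nonneg (g := fun _ => 1) ha hab hb fun _ _ => zero_le_one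
  simp only [one_mul] at h0
  unfold omegaHat
  linarith

/-- The part of a moment over `[a,b]` is at most `b^x ω̂(a)`. -/
theorem IsRadialWeight.integral_rpow_mul_le {ω : ℝ → ℝ} (hω : IsRadialWeight ω) {a b x : ℝ}
    (ha : 0 ≤ a) (hab : a ≤ b) (hb : b ≤ 1) (hx : 0 ≤ x) :
    ∫ r in a..b, r ^ x * ω r ≤ b ^ x * omegaHat ω a := by
  have hb0 : 0 ≤ b ^ x := Real.rpow_nonneg (ha.trans hab) x
  have h1 := hω.integral_mono (g := fun r => r ^ x) (h := fun _ => b ^ x) ha hab hb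
    (hω.intervalIntegrable_rpow_mul ha hab hb hx)
    ((hω.intervalIntegrable ha hab hb).const_mul _)
    fun r hr => Real.rpow_le_rpow (ha.trans hr.1.le) hr.2.le hx
  rw [intervalIntegral.integral_const_mul] at h1
  refine h1.trans (mul_le_mul_of_nonneg_left ?_ hb0)
  have h := intervalIntegral.integral_add_adjacent_intervals
    (hω.intervalIntegrable ha hab hb) (hω.intervalIntegrable (ha.trans hab) hb le_rfl)
  have h0 := hω.integral_nonneg (g := fun _ => 1) (ha.trans hab) hb le_rfl
    fun _ _ => zero_le_one
  simp only [one_mul] at h0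
  unfold omegaHat
  linarith

theorem IsRadialWeight.rpow_mul_omegaHat_le_momentW {ω : ℝ → ℝ} (hω : IsRadialWeight ω)
    {ρ x : ℝ} (h0 : 0 ≤ ρ) (h1 : ρ ≤ 1) (hx : 0 ≤ x) :
    ρ ^ x * omegaHat ω ρ ≤ momentW ω x := by
  have h := intervalIntegral.integral_add_adjacent_intervals
    (hω.intervalIntegrable_rpow_mul le_rfl h0 h1 hx)
    (hω.intervalIntegrable_rpow_mul h0 h1 le_rfl hx)
  have hn := hω.integral_nonneg (g := fun r => r ^ x) le_rfl h0 h1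
    fun r hr => Real.rpow_nonneg hr.1 x
  have hm := hω.integral_mono (g := fun _ => ρ ^ x) (h := fun r => r ^ x) h0 h1 le_rfl
    ((hω.intervalIntegrable h0 h1 le_rfl).const_mul _)
    (hω.intervalIntegrable_rpow_mul h0 h1 le_rfl hx)
    fun r hr => Real.rpow_le_rpow h0 hr.1.le hx
  rw [intervalIntegral.integral_const_mul] at hm
  unfold momentW omegaHat
  linarith

theorem IsRadialWeight.momentW_pos {ω : ℝ → ℝ} (hω : IsRadialWeight ω)
    (hpos : ∀ r ∈ Ico (0:ℝ) 1, 0 < omegaHat ω r) {x : ℝ} (hx : 0 ≤ x) : 0 < momentW ω x := by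
  refine lt_of_lt_of_le ?_
    (hω.rpow_mul_omegaHat_le_momentW (ρ := 1 / 2) (by norm_num) (by norm_num) hx)
  exact mul_pos (Real.rpow_pos_of_pos (by norm_num) x) (hpos _ ⟨by norm_num, by norm_num⟩)

/-- Iterating the doubling inequality: for `ω ∈ D̂` the head of a moment is dominated by the
tail of the weight as soon as `x (1 - s)` is large. -/
theorem IsRadialWeight.integral_head_le {ω : ℝ → ℝ} (hω : IsRadialWeight ω) {C : ℝ}
    (hC : 0 < C) (hD : ∀ r ∈ Ico (0:ℝ) 1, omegaHat ω r ≤ C * omegaHat ω ((1 + r) / 2))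
    (hpos : ∀ r ∈ Ico (0:ℝ) 1, 0 < omegaHat ω r)
    {K : ℝ} (hK : Real.exp (-K) * C ≤ 1 / 2) {x : ℝ} (hx : 0 ≤ x) (j : ℕ) :
    ∀ s ∈ Ico (0:ℝ) 1, (1 / 2 : ℝ) ^ j ≤ 1 - s → K ≤ x * (1 - s) →
      ∫ r in (0:ℝ)..s, r ^ x * ω r ≤ 2 * C * Real.exp (-(x * (1 - s))) * omegaHat ω s := by
  have hpow : ∀ s ∈ Ico (0:ℝ) 1, s ^ x ≤ Real.exp (-(x * (1 - s))) := fun s hs => by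
    have h : s ≤ Real.exp (s - 1) := by linarith [Real.add_one_le_exp (s - 1)]
    calc s ^ x ≤ Real.exp (s - 1) ^ x := Real.rpow_le_rpow hs.1 h hx
      _ = Real.exp (-(x * (1 - s))) := by rw [← Real.exp_mul]; ring_nf
  induction j with
  | zero =>
    intro s hs hj _
    have : s = 0 := le_antisymm (by simpa using hj) hs.1
    subst this
    have := hpos 0 hs
    rw [intervalIntegral.integral_same]
    positivity
  | succ j ih =>
    intro s hs hj hxs
    have hsp := hpos s hs
    have hexp := Real.exp_pos (-(x * (1 - s)))
    rcases lt_or_ge s (1 / 2) with hs2 | hs2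
    · have h0 : omegaHat ω 0 ≤ C * omegaHat ω s := by
        refine (hD 0 ⟨le_rfl, one_pos⟩).trans (mul_le_mul_of_nonneg_left ?_ hC.le)
        exact hω.omegaHat_antitone hs.1 (by linarith) (by norm_num)
      calc ∫ r in (0:ℝ)..s, r ^ x * ω r ≤ s ^ x * omegaHat ω 0 :=
            hω.integral_rpow_mul_le le_rfl hs.1 hs.2.le hx
        _ ≤ Real.exp (-(x * (1 - s))) * (C * omegaHat ω s) :=
            mul_le_mul (hpow s hs) h0 (hpos 0 ⟨le_rfl, one_pos⟩).le hexp.le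
        _ ≤ _ := by nlinarith [mul_pos (mul_pos hC hexp) hsp]
    · have hs' : 2 * s - 1 ∈ Ico (0:ℝ) 1 := ⟨by linarith, by linarith [hs.2]⟩
      have hD' := hD _ hs'
      rw [show (1 + (2 * s - 1)) / 2 = s by ring] at hD'
      have hi := ih _ hs' (by rw [pow_succ] at hj; linarith)
        (by nlinarith [mul_nonneg hx (sub_nonneg.2 hs.2.le)])
      have ht := hω.integral_rpow_mul_le hs'.1 (by linarith [hs.2]) hs.2.le hx (b := s)
      have hsum := intervalIntegral.integral_add_adjacent_intervals
        (hω.intervalIntegrable_rpow_mul le_rfl hs'.1 hs'.2.le hx)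
        (hω.intervalIntegrable_rpow_mul hs'.1 (by linarith [hs.2]) hs.2.le hx (b := s))
      rw [← hsum]
      set e := Real.exp (-(x * (1 - s))) with he
      have he2 : Real.exp (-(x * (1 - (2 * s - 1)))) = e * e := by
        rw [he, ← Real.exp_add]; ring_nf
      have heK : e * C ≤ 1 / 2 := by
        refine le_trans (mul_le_mul_of_nonneg_right ?_ hC.le) hK
        exact Real.exp_le_exp.2 (by linarith)
      rw [he2] at hi
      have h1 : 2 * C * (e * e) * omegaHat ω (2 * s - 1) ≤ C * e * omegaHat ω s := by
        calc 2 * C * (e * e) * omegaHat ω (2 * s - 1)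
            ≤ 2 * C * (e * e) * (C * omegaHat ω s) := by gcongr
          _ = 2 * (e * C) * (C * e * omegaHat ω s) := by ring
          _ ≤ 2 * (1 / 2) * (C * e * omegaHat ω s) := by gcongr
          _ = _ := by ring
      have h2 : s ^ x * omegaHat ω (2 * s - 1) ≤ e * (C * omegaHat ω s) :=
        mul_le_mul (hpow s hs) hD' (hpos _ hs').le hexp.le
      linarith

theorem IsRadialWeight.exists_momentW_le {ω : ℝ → ℝ} (hω : IsRadialWeight ω)
    (hpos : ∀ r ∈ Ico (0:ℝ) 1, 0 < omegaHat ω r) (hD : InDhat ω) :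
    ∃ K ≥ (1:ℝ), ∃ D > (0:ℝ), ∀ x ≥ (0:ℝ), ∀ s ∈ Ico (0:ℝ) 1, K ≤ x * (1 - s) →
      momentW ω x ≤ D * omegaHat ω s := by
  obtain ⟨C, hC, hD⟩ := hD
  refine ⟨max 1 (Real.log (2 * C)), le_max_left _ _, 2 * C + 1, by positivity,
    fun x hx s hs hxs => ?_⟩
  have hK : Real.exp (-(max 1 (Real.log (2 * C)))) * C ≤ 1 / 2 := by
    have : Real.exp (-(max 1 (Real.log (2 * C)))) ≤ (2 * C)⁻¹ := by
      rw [← Real.exp_log (show 0 < 2 * C by positivity), ← Real.exp_neg, Real.log_exp]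
      exact Real.exp_le_exp.2 (neg_le_neg (le_max_right _ _))
    refine (mul_le_mul_of_nonneg_right this hC.le).trans (le_of_eq ?_)
    field_simp
  obtain ⟨j, hj⟩ := exists_pow_lt_of_lt_one (sub_pos.2 hs.2) (show (1 / 2 : ℝ) < 1 by norm_num)
  have hhead := hω.integral_head_le hC hD hpos hK hx j s hs hj.le hxs
  have htail := hω.integral_rpow_mul_le hs.1 hs.2.le le_rfl hx
  have hsum := intervalIntegral.integral_add_adjacent_intervals
    (hω.intervalIntegrable_rpow_mul le_rfl hs.1 hs.2.le hx)
    (hω.intervalIntegrable_rpow_mul hs.1 hs.2.le le_rfl hx)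
  have he : Real.exp (-(x * (1 - s))) ≤ 1 :=
    Real.exp_le_one_iff.2 (neg_nonpos.2 (mul_nonneg hx (sub_nonneg.2 hs.2.le)))
  have h2 : 2 * C * Real.exp (-(x * (1 - s))) * omegaHat ω s ≤ 2 * C * 1 * omegaHat ω s := by
    have := hpos s hs
    gcongr
  rw [Real.one_rpow] at htail
  unfold momentW
  linarith

theorem IsRadialWeight.summable_pow_div_momentW {ω : ℝ → ℝ} (hω : IsRadialWeight ω)
    (hpos : ∀ r ∈ Ico (0:ℝ) 1, 0 < omegaHat ω r) {ρ : ℝ} (h0 : 0 ≤ ρ) (h1 : ρ < 1) :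
    Summable fun n : ℕ => ρ ^ n / momentW ω (2 * (n:ℝ) + 1) := by
  obtain ⟨σ, hσ, hσ1⟩ : ∃ σ : ℝ, ρ < σ ^ 2 ∧ σ ∈ Ioo (0:ℝ) 1 := by
    refine ⟨Real.sqrt ((1 + ρ) / 2), ?_, Real.sqrt_pos.2 (by linarith), ?_⟩
    · rw [Real.sq_sqrt (by linarith)]; linarith
    · rw [Real.sqrt_lt' one_pos]; linarith
  have hw := hpos σ ⟨hσ1.1.le, hσ1.2⟩
  have hσ0 := hσ1.1
  have hg : Summable fun n : ℕ => (ρ / σ ^ 2) ^ n * (σ * omegaHat ω σ)⁻¹ :=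
    (summable_geometric_of_lt_one (by positivity)
      ((div_lt_one (by positivity)).2 hσ)).mul_right _
  refine hg.of_nonneg_of_le (fun n => ?_) (fun n => ?_)
  · have := hω.momentW_pos hpos (x := 2 * (n:ℝ) + 1) (by positivity)
    positivity
  · have h := hω.rpow_mul_omegaHat_le_momentW hσ1.1.le hσ1.2.le
      (x := 2 * (n:ℝ) + 1) (by positivity)
    have e : σ ^ (2 * (n:ℝ) + 1) = σ ^ (2 * n + 1) := by
      rw [← Real.rpow_natCast]; push_cast; rfl
    rw [e] at h
    calc ρ ^ n / momentW ω (2 * (n:ℝ) + 1) ≤ ρ ^ n / (σ ^ (2 * n + 1) * omegaHat ω σ) := by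
          gcongr
      _ = _ := by rw [div_pow, ← pow_mul, pow_succ]; field_simp

theorem integral_exp_mul_sub_pi (k : ℕ) (hk : k ≠ 0) :
    ∫ θ in (0:ℝ)..(2 * Real.pi), Complex.exp (θ * Complex.I) ^ k * ((θ - Real.pi : ℝ) : ℂ) =
      2 * Real.pi / (k * Complex.I) := by
  have hk' : (k : ℂ) ≠ 0 := Nat.cast_ne_zero.2 hk
  have hderiv : ∀ θ : ℝ, HasDerivAt (fun θ : ℝ => Complex.exp (θ * Complex.I) ^ k *
      (((θ - Real.pi : ℝ) : ℂ) / (k * Complex.I) + 1 / (k:ℂ) ^ 2))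
      (Complex.exp (θ * Complex.I) ^ k * ((θ - Real.pi : ℝ) : ℂ)) θ := by
    intro θ
    simp only [← Complex.exp_nat_mul]
    have h1 : HasDerivAt (fun θ : ℝ => Complex.exp (k * (θ * Complex.I)))
        (Complex.exp (k * (θ * Complex.I)) * (k * Complex.I)) θ := by
      have := ((Complex.ofRealCLM.hasDerivAt (x := θ)).mul_const Complex.I).const_mul (k:ℂ)
      simpa using this.cexp
    have h2 : HasDerivAt (fun θ : ℝ => ((θ - Real.pi : ℝ) : ℂ) / (k * Complex.I) + 1 / (k:ℂ) ^ 2)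
        (1 / (k * Complex.I)) θ := by
      have := (((hasDerivAt_id θ).sub_const Real.pi).ofReal_comp.div_const
        ((k:ℂ) * Complex.I)).add_const (1 / (k:ℂ) ^ 2)
      simpa using this
    convert! h1.mul h2 using 1
    field_simp
    linear_combination -Complex.I_sq
  rw [intervalIntegral.integral_eq_sub_of_hasDerivAt (fun θ _ => hderiv θ)
    (Continuous.intervalIntegrable (by fun_prop) _ _)]
  have e : Complex.exp (((2 * Real.pi : ℝ) : ℂ) * Complex.I) = 1 := by
    push_cast; exact Complex.exp_two_pi_mul_I
  rw [e]
  push_cast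
  simp
  field_simp
  ring

/-- Hardy's inequality for power series with nonnegative coefficients. -/
theorem tsum_div_succ_le_integral_norm {a : ℕ → ℝ} (ha : ∀ n, 0 ≤ a n) (hs : Summable a) :
    2 * ∑' n : ℕ, a n / (n + 1) ≤
      ∫ θ in (0:ℝ)..(2 * Real.pi), ‖∑' n : ℕ, (a n : ℂ) * Complex.exp (θ * Complex.I) ^ n‖ := by
  have hπ := Real.pi_pos
  have hnorm : ∀ (n : ℕ) (θ : ℝ), ‖(a n : ℂ) * Complex.exp (θ * Complex.I) ^ n‖ = a n := by
    intro n θ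
    rw [norm_mul, norm_pow, Complex.norm_exp_ofReal_mul_I, one_pow, mul_one, Complex.norm_real,
      Real.norm_of_nonneg (ha n)]
  set f : ℝ → ℂ := fun θ => ∑' n : ℕ, (a n : ℂ) * Complex.exp (θ * Complex.I) ^ n with hf
  have hfc : Continuous f :=
    continuous_tsum (fun n => by fun_prop) hs fun n θ => (hnorm n θ).le
  have hsumm : ∀ θ : ℝ, Summable fun n : ℕ => (a n : ℂ) * Complex.exp (θ * Complex.I) ^ n :=
    fun θ => Summable.of_norm (by simpa only [hnorm] using hs)
  have habs : ∀ θ ∈ Ioc 0 (2 * Real.pi), |θ - Real.pi| ≤ Real.pi := fun θ hθ =>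
    abs_le.2 ⟨by linarith [hθ.1], by linarith [hθ.2]⟩
  have hu : uIoc 0 (2 * Real.pi) = Ioc 0 (2 * Real.pi) := uIoc_of_le (by positivity)
  have hsum := intervalIntegral.hasSum_integral_of_dominated_convergence
    (μ := volume) (a := 0) (b := 2 * Real.pi)
    (F := fun n θ => (a n : ℂ) * Complex.exp (θ * Complex.I) ^ n *
      (Complex.exp (θ * Complex.I) * ((θ - Real.pi : ℝ) : ℂ)))
    (f := fun θ => f θ * (Complex.exp (θ * Complex.I) * ((θ - Real.pi : ℝ) : ℂ)))
    (fun n _ => a n * Real.pi) (fun n => Continuous.aestronglyMeasurable (by fun_prop))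
    (fun n => ae_of_all _ fun θ hθ => by
      rw [norm_mul, hnorm, norm_mul, Complex.norm_exp_ofReal_mul_I, one_mul, Complex.norm_real]
      exact mul_le_mul_of_nonneg_left (habs θ (hu ▸ hθ)) (ha n))
    (ae_of_all _ fun θ _ => hs.mul_right _) (by simp)
    (ae_of_all _ fun θ _ => (hsumm θ).hasSum.mul_right _)
  have hterm : ∀ n : ℕ, ∫ θ in (0:ℝ)..(2 * Real.pi), (a n : ℂ) * Complex.exp (θ * Complex.I) ^ n *
      (Complex.exp (θ * Complex.I) * ((θ - Real.pi : ℝ) : ℂ)) =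
      ((a n / (n + 1) : ℝ) : ℂ) * (2 * Real.pi / Complex.I) := by
    intro n
    have := integral_exp_mul_sub_pi (n + 1) n.succ_ne_zero
    calc _ = ∫ θ in (0:ℝ)..(2 * Real.pi), (a n : ℂ) * (Complex.exp (θ * Complex.I) ^ (n + 1) *
          ((θ - Real.pi : ℝ) : ℂ)) := by congr 1; ext θ; ring
      _ = _ := by
        rw [intervalIntegral.integral_const_mul, this]
        have : (n : ℂ) + 1 ≠ 0 := by exact_mod_cast n.succ_ne_zero
        push_cast
        field_simp
  simp only [hterm] at hsum
  have hs' : Summable fun n : ℕ => a n / (n + 1) :=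
    hs.of_nonneg_of_le (fun n => div_nonneg (ha n) (by positivity))
      fun n => div_le_self (ha n) (by linarith [Nat.cast_nonneg (α := ℝ) n])
  have heq := hsum.unique (((Complex.hasSum_ofReal).2 hs'.hasSum).mul_right _)
  have hle : ‖∫ θ in (0:ℝ)..(2 * Real.pi),
      f θ * (Complex.exp (θ * Complex.I) * ((θ - Real.pi : ℝ) : ℂ))‖ ≤
      ∫ θ in (0:ℝ)..(2 * Real.pi), ‖f θ‖ * Real.pi := by
    refine intervalIntegral.norm_integral_le_of_norm_le (by positivity)
      (ae_of_all _ fun θ hθ => ?_) (Continuous.intervalIntegrable (by fun_prop) _ _)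
    rw [norm_mul, norm_mul, Complex.norm_exp_ofReal_mul_I, one_mul, Complex.norm_real]
    exact mul_le_mul_of_nonneg_left (habs θ hθ) (norm_nonneg _)
  rw [heq, intervalIntegral.integral_mul_const, norm_mul, Complex.norm_real,
    Real.norm_of_nonneg (tsum_nonneg fun n => div_nonneg (ha n) (by positivity)),
    norm_div, Complex.norm_I, div_one, norm_mul, Complex.norm_real, Complex.norm_two,
    Real.norm_of_nonneg hπ.le, ← mul_assoc] at hle
  rw [mul_comm]
  exact le_of_mul_le_mul_right hle hπ

/-- The Hardy sum of the Bergman kernel of `A²_ω`. -/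
def hardySum (ω : ℝ → ℝ) (ρ : ℝ) : ℝ :=
  ∑' n : ℕ, ρ ^ n / momentW ω (2 * (n:ℝ) + 1) / (n + 1)

theorem IsRadialWeight.hardySum_terms_nonneg {ω : ℝ → ℝ} (hω : IsRadialWeight ω)
    (hpos : ∀ r ∈ Ico (0:ℝ) 1, 0 < omegaHat ω r) {ρ : ℝ} (h0 : 0 ≤ ρ) (n : ℕ) :
    0 ≤ ρ ^ n / momentW ω (2 * (n:ℝ) + 1) := by
  have := hω.momentW_pos hpos (x := 2 * (n:ℝ) + 1) (by positivity)
  positivity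

theorem IsRadialWeight.summable_hardySum {ω : ℝ → ℝ} (hω : IsRadialWeight ω)
    (hpos : ∀ r ∈ Ico (0:ℝ) 1, 0 < omegaHat ω r) {ρ : ℝ} (h0 : 0 ≤ ρ) (h1 : ρ < 1) :
    Summable fun n : ℕ => ρ ^ n / momentW ω (2 * (n:ℝ) + 1) / (n + 1) :=
  (hω.summable_pow_div_momentW hpos h0 h1).of_nonneg_of_le
    (fun n => div_nonneg (hω.hardySum_terms_nonneg hpos h0 n) (by positivity))
    fun n => div_le_self (hω.hardySum_terms_nonneg hpos h0 n)
      (by linarith [Nat.cast_nonneg (α := ℝ) n])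

theorem IsRadialWeight.hardySum_nonneg {ω : ℝ → ℝ} (hω : IsRadialWeight ω)
    (hpos : ∀ r ∈ Ico (0:ℝ) 1, 0 < omegaHat ω r) {ρ : ℝ} (h0 : 0 ≤ ρ) : 0 ≤ hardySum ω ρ :=
  tsum_nonneg fun n => div_nonneg (hω.hardySum_terms_nonneg hpos h0 n) (by positivity)

theorem IsRadialWeight.hardySum_mono {ω : ℝ → ℝ} (hω : IsRadialWeight ω)
    (hpos : ∀ r ∈ Ico (0:ℝ) 1, 0 < omegaHat ω r) {ρ σ : ℝ} (h0 : 0 ≤ ρ) (h : ρ ≤ σ)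
    (h1 : σ < 1) : hardySum ω ρ ≤ hardySum ω σ := by
  refine (hω.summable_hardySum hpos h0 (h.trans_lt h1)).tsum_le_tsum (fun n => ?_)
    (hω.summable_hardySum hpos (h0.trans h) h1)
  have := hω.momentW_pos hpos (x := 2 * (n:ℝ) + 1) (by positivity)
  gcongr

theorem IsRadialWeight.inv_momentW_one_le_hardySum {ω : ℝ → ℝ} (hω : IsRadialWeight ω)
    (hpos : ∀ r ∈ Ico (0:ℝ) 1, 0 < omegaHat ω r) {ρ : ℝ} (h0 : 0 ≤ ρ) (h1 : ρ < 1) :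
    1 / momentW ω 1 ≤ hardySum ω ρ := by
  have := (hω.summable_hardySum hpos h0 h1).le_tsum 0
    fun n _ => div_nonneg (hω.hardySum_terms_nonneg hpos h0 n) (by positivity)
  simpa [hardySum] using this

/-- Hardy's inequality for the Bergman kernel along a circle, with an arbitrary base point. -/
theorem IsRadialWeight.hardySum_le_integral_norm_bergmanKernel {ω : ℝ → ℝ}
    (hω : IsRadialWeight ω) (hpos : ∀ r ∈ Ico (0:ℝ) 1, 0 < omegaHat ω r) {r s α : ℝ}
    (hr : 0 ≤ r) (hs : 0 ≤ s) (hrs : s * r < 1) :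
    hardySum ω (s * r) ≤ ∫ θ in (-Real.pi)..Real.pi,
      ‖bergmanKernel ω (circlePt r α) (circlePt s θ)‖ := by
  set a : ℕ → ℝ := fun n => (s * r) ^ n / momentW ω (2 * (n:ℝ) + 1) / 2 with ha
  have h := tsum_div_succ_le_integral_norm (a := a)
    (fun n => div_nonneg (hω.hardySum_terms_nonneg hpos (by positivity) n) zero_le_two)
    ((hω.summable_pow_div_momentW hpos (by positivity) hrs).div_const _)
  set g : ℝ → ℝ := fun θ => ‖∑' n : ℕ, (a n : ℂ) * Complex.exp (θ * Complex.I) ^ n‖ with hg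
  have hper : Function.Periodic g (2 * Real.pi) := by
    intro θ
    have : Complex.exp (((θ + 2 * Real.pi : ℝ) : ℂ) * Complex.I) =
        Complex.exp (θ * Complex.I) := by
      push_cast
      rw [add_mul]
      exact Complex.exp_periodic _
    simp only [hg, this]
  have e1 : ∀ θ : ℝ, ‖bergmanKernel ω (circlePt r α) (circlePt s θ)‖ = g (θ - α) := by
    intro θ
    have : circlePt s θ * (starRingEnd ℂ) (circlePt r α) =
        ((s * r : ℝ) : ℂ) * Complex.exp (((θ - α : ℝ) : ℂ) * Complex.I) := by
      unfold circlePt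
      rw [map_mul, Complex.conj_ofReal, ← Complex.exp_conj, map_mul, Complex.conj_ofReal,
        Complex.conj_I]
      push_cast
      rw [sub_mul, sub_eq_add_neg, Complex.exp_add]
      ring_nf
    simp only [hg, bergmanKernel, this]
    congr 2
    ext n
    simp only [ha]
    push_cast
    ring
  have e2 : 2 * ∑' n : ℕ, a n / (n + 1) = hardySum ω (s * r) := by
    rw [hardySum, ← tsum_mul_left]
    congr 1
    ext n
    simp only [ha]
    ring
  simp only [e1]
  rw [intervalIntegral.integral_comp_sub_right, ← e2]
  refine h.trans (le_of_eq ?_)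
  have := hper.intervalIntegral_add_eq 0 (-Real.pi - α)
  rw [zero_add] at this
  rw [this]
  congr 1
  ring

/-- For `ω ∈ D̂` the coefficient sums of the kernel dominate `1 / (ω̂(s) (1 - s))`. -/
theorem IsRadialWeight.exists_inv_le_tsum {ω : ℝ → ℝ} (hω : IsRadialWeight ω)
    (hpos : ∀ r ∈ Ico (0:ℝ) 1, 0 < omegaHat ω r) (hD : InDhat ω) :
    ∃ A > (0:ℝ), ∀ s ∈ Ico (1 / 2 : ℝ) 1, ENNReal.ofReal (1 / (omegaHat ω s * (1 - s))) ≤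
      ENNReal.ofReal A *
        ∑' n : ℕ, ENNReal.ofReal (2 * s ^ (2 * n + 1) / momentW ω (2 * (n:ℝ) + 1)) := by
  obtain ⟨K, hK1, D, hD0, hmom⟩ := hω.exists_momentW_le hpos hD
  refine ⟨D * Real.exp (8 * K + 8), by positivity, fun s hs => ?_⟩
  have hs0 : 0 < s := by linarith [hs.1]
  have hs1 : 0 < 1 - s := by linarith [hs.2]
  have hsI : s ∈ Ico (0:ℝ) 1 := ⟨hs0.le, hs.2⟩
  have hws := hpos s hsI
  obtain ⟨N, hN1, hN2⟩ : ∃ N : ℕ, K ≤ N * (1 - s) ∧ N * (1 - s) ≤ K + 1 := by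
    refine ⟨⌈K / (1 - s)⌉₊, ?_, ?_⟩
    · have := Nat.le_ceil (K / (1 - s))
      rwa [div_le_iff₀ hs1] at this
    · have := (Nat.ceil_lt_add_one (show 0 ≤ K / (1 - s) by positivity)).le
      calc _ ≤ (K / (1 - s) + 1) * (1 - s) := mul_le_mul_of_nonneg_right this hs1.le
        _ = K + (1 - s) := by field_simp
        _ ≤ K + 1 := by linarith
  have hpow : Real.exp (-(8 * K + 8)) ≤ s ^ (4 * N) := by
    have hlog : -(2 * (1 - s)) ≤ Real.log s := by
      have h1 := Real.one_sub_inv_le_log_of_pos hs0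
      have h2 : s⁻¹ ≤ 1 + 2 * (1 - s) := by
        rw [inv_le_iff_one_le_mul₀ hs0]
        nlinarith [hs.1]
      linarith
    rw [← Real.exp_log hs0, ← Real.exp_nat_mul, Real.exp_le_exp]
    push_cast
    have : (0:ℝ) ≤ 4 * N := by positivity
    nlinarith [mul_le_mul_of_nonneg_left hlog this]
  have hterm : ∀ n ∈ Finset.Ico N (2 * N), Real.exp (-(8 * K + 8)) / (D * omegaHat ω s) ≤
      2 * s ^ (2 * n + 1) / momentW ω (2 * (n:ℝ) + 1) := by
    intro n hn
    rw [Finset.mem_Ico] at hn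
    have hnN : (N:ℝ) ≤ n := by exact_mod_cast hn.1
    have hm := hω.momentW_pos hpos (x := 2 * (n:ℝ) + 1) (by positivity)
    have hle : momentW ω (2 * (n:ℝ) + 1) ≤ D * omegaHat ω s :=
      hmom _ (by positivity) s hsI (hN1.trans (by gcongr; linarith))
    have hnum : Real.exp (-(8 * K + 8)) ≤ 2 * s ^ (2 * n + 1) := by
      calc _ ≤ s ^ (4 * N) := hpow
        _ ≤ s ^ (2 * n) := pow_le_pow_of_le_one hs0.le hs.2.le (by omega)
        _ = 1 * s ^ (2 * n) := (one_mul _).symm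
        _ ≤ (2 * s) * s ^ (2 * n) := by gcongr; linarith [hs.1]
        _ = _ := by ring
    gcongr
  have hfin : 1 / (omegaHat ω s * (1 - s)) ≤ (D * Real.exp (8 * K + 8)) *
      ∑ n ∈ Finset.Ico N (2 * N), 2 * s ^ (2 * n + 1) / momentW ω (2 * (n:ℝ) + 1) := by
    have h1 := Finset.card_nsmul_le_sum _ _ _ hterm
    rw [Nat.card_Ico, show 2 * N - N = N by omega, nsmul_eq_mul] at h1
    calc 1 / (omegaHat ω s * (1 - s)) ≤ N / omegaHat ω s := by
          rw [div_le_div_iff₀ (by positivity) hws]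
          nlinarith [mul_le_mul_of_nonneg_right (hK1.le.trans hN1) hws.le]
      _ = (D * Real.exp (8 * K + 8)) *
          (N * (Real.exp (-(8 * K + 8)) / (D * omegaHat ω s))) := by
          rw [Real.exp_neg]; field_simp
      _ ≤ _ := by gcongr
  calc _ ≤ ENNReal.ofReal ((D * Real.exp (8 * K + 8)) *
      ∑ n ∈ Finset.Ico N (2 * N), 2 * s ^ (2 * n + 1) / momentW ω (2 * (n:ℝ) + 1)) :=
        ENNReal.ofReal_le_ofReal hfin
    _ = ENNReal.ofReal (D * Real.exp (8 * K + 8)) * ∑ n ∈ Finset.Ico N (2 * N),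
        ENNReal.ofReal (2 * s ^ (2 * n + 1) / momentW ω (2 * (n:ℝ) + 1)) := by
        rw [ENNReal.ofReal_mul (by positivity), ENNReal.ofReal_sum_of_nonneg]
        intro n _
        have hm := hω.momentW_pos hpos (x := 2 * (n:ℝ) + 1) (by positivity)
        positivity
    _ ≤ _ := by gcongr; exact ENNReal.sum_le_tsum _

theorem IsRadialWeight.lintegral_tsum_le_hardySum {ω : ℝ → ℝ} (hω : IsRadialWeight ω)
    (hpos : ∀ r ∈ Ico (0:ℝ) 1, 0 < omegaHat ω r) {r : ℝ} (hr : r ∈ Ico (0:ℝ) 1) :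
    ∫⁻ s in Ioc 0 r, ∑' n : ℕ,
      ENNReal.ofReal (2 * s ^ (2 * n + 1) / momentW ω (2 * (n:ℝ) + 1)) ≤
      ENNReal.ofReal (hardySum ω (r ^ 2)) := by
  have hr2 : r ^ 2 < 1 := by nlinarith [hr.1, hr.2]
  rw [lintegral_tsum fun n => Measurable.aemeasurable (by fun_prop), hardySum,
    ENNReal.ofReal_tsum_of_nonneg
      (fun n => div_nonneg (hω.hardySum_terms_nonneg hpos (by positivity) n) (by positivity))
      (hω.summable_hardySum hpos (by positivity) hr2)]
  refine ENNReal.tsum_le_tsum fun n => ?_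
  have hm := hω.momentW_pos hpos (x := 2 * (n:ℝ) + 1) (by positivity)
  rw [← ofReal_integral_eq_lintegral_ofReal]
  · refine ENNReal.ofReal_le_ofReal ?_
    rw [← intervalIntegral.integral_of_le hr.1, intervalIntegral.integral_div,
      intervalIntegral.integral_const_mul, integral_pow]
    have e : 2 * ((r ^ (2 * n + 1 + 1) - 0 ^ (2 * n + 1 + 1)) / (((2 * n + 1 : ℕ) : ℝ) + 1)) /
        momentW ω (2 * (n:ℝ) + 1) =
        r ^ 2 * ((r ^ 2) ^ n / momentW ω (2 * (n:ℝ) + 1) / (n + 1)) := by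
      rw [zero_pow (by omega)]
      push_cast
      field_simp
      ring
    rw [e]
    exact mul_le_of_le_one_left
      (div_nonneg (hω.hardySum_terms_nonneg hpos (by positivity) n) (by positivity)) hr2.le
  · exact (Continuous.integrableOn_Icc (by fun_prop)).mono_set Ioc_subset_Icc_self
  · filter_upwards [ae_restrict_mem measurableSet_Ioc] with s hs
    have := hs.1
    simp only [Pi.zero_apply]
    positivity

theorem Jomega_nonneg {ω : ℝ → ℝ}
    (hpos : ∀ r ∈ Ico (0:ℝ) 1, 0 < omegaHat ω r) {r : ℝ} (hr : r ∈ Ico (0:ℝ) 1) :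
    0 ≤ Jomega ω r := by
  refine intervalIntegral.integral_nonneg hr.1 fun s hs => ?_
  have h1 : s < 1 := hs.2.trans_lt hr.2
  exact one_div_nonneg.2 (mul_nonneg (hpos s ⟨hs.1, h1⟩).le (sub_nonneg.2 h1.le))

/-- `1 + J_ω(r)` is dominated by the Hardy sum of the Bergman kernel at `r²`. -/
theorem IsRadialWeight.exists_one_add_Jomega_le {ω : ℝ → ℝ} (hω : IsRadialWeight ω)
    (hpos : ∀ r ∈ Ico (0:ℝ) 1, 0 < omegaHat ω r) (hD : InDhat ω) :
    ∃ B > (0:ℝ), ∀ r ∈ Ico (0:ℝ) 1, 1 + Jomega ω r ≤ B * hardySum ω (r ^ 2) := by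
  obtain ⟨A, hA, hinv⟩ := hω.exists_inv_le_tsum hpos hD
  have hhalf := hpos (1 / 2) ⟨by norm_num, by norm_num⟩
  have hm := hω.momentW_pos hpos (x := 1) zero_le_one
  set E : ℝ := 2 / omegaHat ω (1 / 2) with hE
  have hE0 : 0 < E := by positivity
  refine ⟨(1 + E) * momentW ω 1 + A, by positivity, fun r hr => ?_⟩
  have hr2 : r ^ 2 < 1 := by nlinarith [hr.1, hr.2]
  have hS := hω.hardySum_nonneg hpos (sq_nonneg r)
  have hS1 := hω.inv_momentW_one_le_hardySum hpos (sq_nonneg r) hr2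
  rw [div_le_iff₀ hm] at hS1
  have hJ : ENNReal.ofReal (Jomega ω r) ≤ ENNReal.ofReal (E + A * hardySum ω (r ^ 2)) := by
    rw [Jomega, intervalIntegral.integral_of_le hr.1]
    refine (Real.ofReal_le_enorm _).trans ((enorm_integral_le_lintegral_enorm _).trans ?_)
    have hpt : ∀ s ∈ Ioc 0 r, ‖1 / (omegaHat ω s * (1 - s))‖ₑ ≤ ENNReal.ofReal E +
        ENNReal.ofReal A *
          ∑' n : ℕ, ENNReal.ofReal (2 * s ^ (2 * n + 1) / momentW ω (2 * (n:ℝ) + 1)) := by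
      intro s hs
      have hs1 : s < 1 := hs.2.trans_lt hr.2
      have hws := hpos s ⟨hs.1.le, hs1⟩
      have hs1' : 0 < 1 - s := by linarith
      rw [Real.enorm_of_nonneg (by positivity)]
      rcases lt_or_ge s (1 / 2) with h | h
      · refine le_add_right (ENNReal.ofReal_le_ofReal ?_)
        have hmono := hω.omegaHat_antitone hs.1.le h.le (by norm_num)
        rw [hE, div_le_div_iff₀ (by positivity) hhalf]
        nlinarith
      · exact le_add_left (hinv s ⟨h, hs1⟩)
    calc _ ≤ ∫⁻ s in Ioc 0 r, (ENNReal.ofReal E + ENNReal.ofReal A *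
          ∑' n : ℕ, ENNReal.ofReal (2 * s ^ (2 * n + 1) / momentW ω (2 * (n:ℝ) + 1))) :=
          setLIntegral_mono' measurableSet_Ioc hpt
      _ ≤ ENNReal.ofReal E + ENNReal.ofReal A * ENNReal.ofReal (hardySum ω (r ^ 2)) := by
          rw [lintegral_add_left measurable_const, lintegral_const_mul' _ _ ENNReal.ofReal_ne_top]
          gcongr
          · rw [setLIntegral_const, Real.volume_Ioc, sub_zero]
            exact mul_le_of_le_one_right' (ENNReal.ofReal_le_one.2 hr.2.le)
          · exact hω.lintegral_tsum_le_hardySum hpos hr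
      _ = _ := by
          rw [ENNReal.ofReal_add hE0.le (by positivity), ENNReal.ofReal_mul hA.le]
  rw [ENNReal.ofReal_le_ofReal_iff (by positivity)] at hJ
  nlinarith

theorem norm_circlePt {s : ℝ} (hs : 0 ≤ s) (θ : ℝ) : ‖circlePt s θ‖ = s := by
  rw [circlePt, norm_mul, Complex.norm_exp_ofReal_mul_I, mul_one, Complex.norm_real,
    Real.norm_of_nonneg hs]

theorem continuous_circlePt : Continuous fun p : ℝ × ℝ => circlePt p.1 p.2 := by
  unfold circlePt
  fun_prop

theorem IsRadialWeight.continuousOn_bergmanKernel {ω : ℝ → ℝ} (hω : IsRadialWeight ω)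
    (hpos : ∀ r ∈ Ico (0:ℝ) 1, 0 < omegaHat ω r) {z : ℂ} (hz : ‖z‖ < 1) :
    ContinuousOn (bergmanKernel ω z) (Metric.ball 0 1) := by
  refine continuousOn_tsum (u := fun n : ℕ => ‖z‖ ^ n / momentW ω (2 * (n:ℝ) + 1))
    (fun n => by fun_prop) (hω.summable_pow_div_momentW hpos (norm_nonneg z) hz)
    fun n ζ hζ => ?_
  rw [mem_ball_zero_iff] at hζ
  have hm := hω.momentW_pos hpos (x := 2 * (n:ℝ) + 1) (by positivity)
  rw [norm_div, norm_pow, norm_mul, RCLike.norm_conj, norm_mul, Complex.norm_two,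
    Complex.norm_real, Real.norm_of_nonneg hm.le]
  have h1 : (‖ζ‖ * ‖z‖) ^ n ≤ ‖z‖ ^ n :=
    pow_le_pow_left₀ (by positivity) (mul_le_of_le_one_left (norm_nonneg z) hζ.le) n
  gcongr
  linarith

/-- The maximal projection of the indicator of an annulus is bounded below by the Hardy sum. -/
theorem IsRadialWeight.le_PomegaPlusL_indicator {ω : ℝ → ℝ} (hω : IsRadialWeight ω)
    (hpos : ∀ r ∈ Ico (0:ℝ) 1, 0 < omegaHat ω r) {r t α : ℝ} (hr : 0 ≤ r) (hrt : r ≤ t)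
    (ht : t ∈ Ico (1 / 2 : ℝ) 1) :
    ENNReal.ofReal (hardySum ω (r ^ 2) * (omegaHat ω t / (2 * Real.pi))) ≤
      PomegaPlusL ω ({ζ : ℂ | t ≤ ‖ζ‖}.indicator fun _ => 1) (circlePt r α) := by
  have hπ := Real.pi_pos
  have hr1 : r < 1 := hrt.trans_lt ht.2
  have ht0 : 0 ≤ t := hr.trans hrt
  set z := circlePt r α with hz
  have hzn : ‖z‖ < 1 := by rw [hz, norm_circlePt hr]; exact hr1
  set f : ℂ → ℂ := {ζ : ℂ | t ≤ ‖ζ‖}.indicator fun _ => 1 with hf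
  have hcont := hω.continuousOn_bergmanKernel hpos hzn
  have hωi : IntegrableOn ω (Ioo t 1) :=
    hω.2.mono_set fun s hs => ⟨ht0.trans hs.1.le, hs.2⟩
  have hpt : ∀ p ∈ Ioo t 1 ×ˢ Ioo (-Real.pi) Real.pi,
      ENNReal.ofReal (p.1 * ω p.1 / Real.pi) *
        ENNReal.ofReal ‖bergmanKernel ω z (circlePt p.1 p.2)‖ =
      ENNReal.ofReal p.1 • (Metric.ball (0:ℂ) 1).indicator
        (fun ζ => ENNReal.ofReal (‖f ζ‖ * ‖bergmanKernel ω z ζ‖ * ω ‖ζ‖ / Real.pi))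
        (Complex.polarCoord.symm p) := by
    rintro ⟨s, θ⟩ ⟨hs, -⟩
    simp only at hs
    have hs0 : 0 ≤ s := ht0.trans hs.1.le
    have hsω := hω.1 s ⟨hs0, hs.2⟩
    have e : Complex.polarCoord.symm (s, θ) = circlePt s θ := by
      rw [Complex.polarCoord_symm_apply, circlePt, Complex.exp_mul_I]
      push_cast
      rfl
    have hmem : circlePt s θ ∈ Metric.ball (0:ℂ) 1 := by
      rw [mem_ball_zero_iff, norm_circlePt hs0]; exact hs.2
    have hf1 : f (circlePt s θ) = 1 :=
      indicator_of_mem (by rw [mem_ofPred_eq, norm_circlePt hs0]; exact hs.1.le) _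
    rw [e, indicator_of_mem hmem, hf1, norm_circlePt hs0, smul_eq_mul,
      ← ENNReal.ofReal_mul (by positivity), ← ENNReal.ofReal_mul hs0, norm_one]
    congr 1
    ring
  have hmeas : AEMeasurable (fun p : ℝ × ℝ => ENNReal.ofReal (p.1 * ω p.1 / Real.pi) *
      ENNReal.ofReal ‖bergmanKernel ω z (circlePt p.1 p.2)‖)
      ((volume.restrict (Ioo t 1)).prod (volume.restrict (Ioo (-Real.pi) Real.pi))) := by
    apply AEMeasurable.fun_mul
    · have h1 : AEMeasurable (fun s => s * ω s / Real.pi) (volume.restrict (Ioo t 1)) :=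
        (measurable_id.aemeasurable.mul hωi.aestronglyMeasurable.aemeasurable).div_const _
      exact h1.ennreal_ofReal.comp_fst
    · rw [Measure.prod_restrict, ← Measure.volume_eq_prod]
      refine AEMeasurable.ennreal_ofReal (ContinuousOn.aemeasurable ?_
        (measurableSet_Ioo.prod measurableSet_Ioo))
      refine (hcont.comp continuous_circlePt.continuousOn ?_).norm
      rintro ⟨s, θ⟩ ⟨hs, -⟩
      simp only at hs
      rw [mem_ball_zero_iff, norm_circlePt (ht0.trans hs.1.le)]
      exact hs.2
  have hsub : Ioo t 1 ×ˢ Ioo (-Real.pi) Real.pi ⊆ Complex.polarCoord.target := by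
    rw [Complex.polarCoord_target]
    exact prod_mono (fun s hs => ht0.trans_lt hs.1) subset_rfl
  have hinner : ∀ s ∈ Ioo t 1,
      ENNReal.ofReal (ω s * (hardySum ω (r ^ 2) / (2 * Real.pi))) ≤
      ∫⁻ θ in Ioo (-Real.pi) Real.pi, ENNReal.ofReal (s * ω s / Real.pi) *
        ENNReal.ofReal ‖bergmanKernel ω z (circlePt s θ)‖ := by
    intro s hs
    have hs0 : 0 ≤ s := ht0.trans hs.1.le
    have hsω := hω.1 s ⟨hs0, hs.2⟩
    have hsr : s * r < 1 := by nlinarith [hs.2]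
    have hS := hω.hardySum_nonneg hpos (sq_nonneg r)
    have hS1 : hardySum ω (r ^ 2) ≤ hardySum ω (s * r) :=
      hω.hardySum_mono hpos (sq_nonneg r) (by nlinarith [hs.1]) hsr
    have hH := hω.hardySum_le_integral_norm_bergmanKernel hpos (α := α) hr hs0 hsr
    rw [intervalIntegral.integral_of_le (by linarith), integral_Ioc_eq_integral_Ioo] at hH
    have hH' : ENNReal.ofReal (hardySum ω (r ^ 2)) ≤ ∫⁻ θ in Ioo (-Real.pi) Real.pi,
        ENNReal.ofReal ‖bergmanKernel ω z (circlePt s θ)‖ := by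
      refine (ENNReal.ofReal_le_ofReal (hS1.trans hH)).trans ((Real.ofReal_le_enorm _).trans
        ((enorm_integral_le_lintegral_enorm _).trans (le_of_eq ?_)))
      simp only [Real.enorm_of_nonneg (norm_nonneg _)]
      rfl
    rw [lintegral_const_mul' _ _ ENNReal.ofReal_ne_top]
    refine le_trans ?_ (mul_le_mul_right hH' _)
    rw [← ENNReal.ofReal_mul (by positivity)]
    refine ENNReal.ofReal_le_ofReal ?_
    have hhalf : 1 / 2 ≤ s := ht.1.trans hs.1.le
    calc ω s * (hardySum ω (r ^ 2) / (2 * Real.pi))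
        = (1 / 2) * (ω s * hardySum ω (r ^ 2) / Real.pi) := by ring
      _ ≤ s * (ω s * hardySum ω (r ^ 2) / Real.pi) := by gcongr
      _ = _ := by ring
  calc ENNReal.ofReal (hardySum ω (r ^ 2) * (omegaHat ω t / (2 * Real.pi)))
      = ∫⁻ s in Ioo t 1, ENNReal.ofReal (ω s * (hardySum ω (r ^ 2) / (2 * Real.pi))) := by
        rw [← ofReal_integral_eq_lintegral_ofReal (hωi.mul_const _), integral_mul_const,
          omegaHat, intervalIntegral.integral_of_le ht.2.le, integral_Ioc_eq_integral_Ioo]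
        · congr 1; ring
        · filter_upwards [ae_restrict_mem measurableSet_Ioo] with s hs
          have := hω.1 s ⟨ht0.trans hs.1.le, hs.2⟩
          have hS := hω.hardySum_nonneg hpos (sq_nonneg r)
          simp only [Pi.zero_apply]
          positivity
    _ ≤ ∫⁻ s in Ioo t 1, ∫⁻ θ in Ioo (-Real.pi) Real.pi,
        ENNReal.ofReal (s * ω s / Real.pi) *
          ENNReal.ofReal ‖bergmanKernel ω z (circlePt s θ)‖ :=
        setLIntegral_mono' measurableSet_Ioo hinner
    _ = ∫⁻ p in Ioo t 1 ×ˢ Ioo (-Real.pi) Real.pi,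
        ENNReal.ofReal (p.1 * ω p.1 / Real.pi) *
          ENNReal.ofReal ‖bergmanKernel ω z (circlePt p.1 p.2)‖ := by
        rw [Measure.volume_eq_prod, ← Measure.prod_restrict, lintegral_prod _ hmeas]
    _ = _ := setLIntegral_congr_fun (measurableSet_Ioo.prod measurableSet_Ioo) hpt
    _ ≤ _ := lintegral_mono_set hsub
    _ = _ := by
        refine (Complex.lintegral_comp_polarCoord_symm _).trans ?_
        rw [lintegral_indicator measurableSet_ball]
        rfl

theorem ofReal_inv_two_pi_mul_volume :
    ENNReal.ofReal (1 / (2 * Real.pi)) * volume (Ioo (0:ℝ) (2 * Real.pi)) = 1 := by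
  have := Real.pi_pos
  rw [Real.volume_Ioo, sub_zero, ← ENNReal.ofReal_mul (by positivity),
    one_div_mul_cancel (by positivity), ENNReal.ofReal_one]

theorem le_MpEE_of_forall_le {p r : ℝ} (hp : 0 < p) {F : ℂ → ℝ≥0∞} {c : ℝ≥0∞}
    (h : ∀ θ, c ≤ F (circlePt r θ)) : c ≤ MpEE p r F := by
  calc c = (c ^ p) ^ (1 / p) := by
        rw [← ENNReal.rpow_mul, mul_one_div_cancel hp.ne', ENNReal.rpow_one]
    _ = (ENNReal.ofReal (1 / (2 * Real.pi)) *
        ∫⁻ _ in Ioo (0:ℝ) (2 * Real.pi), c ^ p) ^ (1 / p) := by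
        rw [setLIntegral_const, mul_left_comm, ofReal_inv_two_pi_mul_volume, mul_one]
    _ ≤ _ := ENNReal.rpow_le_rpow (mul_le_mul_right
        (lintegral_mono fun θ => ENNReal.rpow_le_rpow (h θ) hp.le) _) (by positivity)

theorem MpE_indicator_annulus_le {p r t : ℝ} (hp : 0 < p) (hr : 0 ≤ r) :
    MpE p r ({ζ : ℂ | t ≤ ‖ζ‖}.indicator fun _ => 1) ≤ (Ici t).indicator (fun _ => 1) r := by
  by_cases h : t ≤ r
  · have e : ∀ θ, ({ζ : ℂ | t ≤ ‖ζ‖}.indicator (fun _ => (1:ℂ))) (circlePt r θ) = 1 := fun θ =>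
      indicator_of_mem (by rw [mem_ofPred_eq, norm_circlePt hr]; exact h) _
    simp only [MpE, e]
    rw [norm_one, Real.one_rpow, ENNReal.ofReal_one, setLIntegral_const, one_mul,
      ofReal_inv_two_pi_mul_volume, ENNReal.one_rpow, indicator_of_mem (mem_Ici.2 h)]
  · have e : ∀ θ, ({ζ : ℂ | t ≤ ‖ζ‖}.indicator (fun _ => (1:ℂ))) (circlePt r θ) = 0 := fun θ =>
      indicator_of_notMem (by rw [mem_ofPred_eq, norm_circlePt hr]; exact h) _
    simp only [MpE, e]
    rw [norm_zero, Real.zero_rpow hp.ne', ENNReal.ofReal_zero, lintegral_zero, mul_zero,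
      ENNReal.zero_rpow_of_pos (by positivity)]
    exact zero_le

theorem IsRadialWeight.LpqNormE_indicator_annulus_le {ω : ℝ → ℝ} (hω : IsRadialWeight ω)
    {p q t : ℝ} (hp : 0 < p) (hq : 0 < q) (ht : t ∈ Ico (0:ℝ) 1) :
    LpqNormE ω p q ({ζ : ℂ | t ≤ ‖ζ‖}.indicator fun _ => 1) ≤
      ENNReal.ofReal (omegaHat ω t) ^ (1 / q) := by
  refine ENNReal.rpow_le_rpow ?_ (by positivity)
  have hsub : Ici t ∩ Ioo 0 1 ⊆ Icc t 1 := fun r hr => ⟨hr.1, hr.2.2.le⟩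
  calc _ ≤ ∫⁻ r in Ioo (0:ℝ) 1, (Ici t).indicator (fun r => ENNReal.ofReal (ω r)) r := by
        refine setLIntegral_mono' measurableSet_Ioo fun r hr => ?_
        have hle := MpE_indicator_annulus_le (t := t) hp hr.1.le
        by_cases h : r ∈ Ici t
        · rw [indicator_of_mem h] at hle ⊢
          refine (mul_le_of_le_one_left' (ENNReal.rpow_le_one hle hq.le)).trans
            (ENNReal.ofReal_le_ofReal ?_)
          exact mul_le_of_le_one_left (hω.1 r ⟨hr.1.le, hr.2⟩) hr.2.le
        · rw [indicator_of_notMem h] at hle ⊢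
          rw [le_antisymm hle zero_le, ENNReal.zero_rpow_of_pos hq, zero_mul]
    _ = ∫⁻ r in Ici t ∩ Ioo 0 1, ENNReal.ofReal (ω r) := by
        rw [lintegral_indicator measurableSet_Ici, Measure.restrict_restrict measurableSet_Ici]
    _ ≤ ∫⁻ r in Icc t 1, ENNReal.ofReal (ω r) := lintegral_mono_set hsub
    _ = ∫⁻ r in Ico t 1, ENNReal.ofReal (ω r) := setLIntegral_congr Ico_ae_eq_Icc.symm
    _ = _ := by
        rw [← ofReal_integral_eq_lintegral_ofReal (hω.2.mono_set (Ico_subset_Ico_left ht.1)),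
          omegaHat, intervalIntegral.integral_of_le ht.2.le, integral_Ioc_eq_integral_Ioo,
          integral_Ico_eq_integral_Ioo]
        filter_upwards [ae_restrict_mem measurableSet_Ico] with s hs
        exact hω.1 s ⟨ht.1.trans hs.1, hs.2⟩

/-- If `P_ω⁺` is bounded on `L^{p,q}_ω` (`ω ∈ D̂`, `1<p,q<∞`), then
`sup_{1/2≤t<1} (∫_{1/2}^t (1+J_ω(r))^q ω(r) dr)^{1/q} ω̂(t)^{1/q'} < ∞`. -/
theorem PomegaPlus_bounded_necessary
    (ω : ℝ → ℝ) (hω : IsRadialWeight ω)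
    (hpos : ∀ r ∈ Set.Ico (0:ℝ) 1, 0 < omegaHat ω r)
    (hD : InDhat ω)
    (p q q' : ℝ) (hp : 1 < p) (hq : 1 < q) (hq' : q' = q / (q - 1))
    (hbdd : ∃ C > (0:ℝ), ∀ f : ℂ → ℂ,
      MeasureTheory.AEStronglyMeasurable f
        (MeasureTheory.volume.restrict (Metric.ball (0:ℂ) 1)) →
      LpqNormE ω p q f < ⊤ →
      LpqNormEE ω p q (PomegaPlusL ω f) ≤ ENNReal.ofReal C * LpqNormE ω p q f) :
    ∃ M : ℝ, ∀ t ∈ Set.Ico (1/2 : ℝ) 1,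
      (∫ r in (1/2 : ℝ)..t, (1 + Jomega ω r) ^ q * ω r) ^ (1/q) *
        omegaHat ω t ^ (1/q') ≤ M := by
  obtain ⟨C, hC, hbdd⟩ := hbdd
  obtain ⟨B, hB, hJ⟩ := hω.exists_one_add_Jomega_le hpos hD
  have hp0 : 0 < p := by linarith
  have hq0 : 0 < q := by linarith
  have hπ := Real.pi_pos
  refine ⟨(2 * (2 * Real.pi * B * C) ^ q) ^ (1 / q), fun t ht => ?_⟩
  have ht0 : t ∈ Ico (0:ℝ) 1 := ⟨by linarith [ht.1], ht.2⟩
  have hW := hpos t ht0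
  set W := omegaHat ω t with hWdef
  set X := ∫ r in (1/2 : ℝ)..t, (1 + Jomega ω r) ^ q * ω r with hX
  have hbase : ∀ r ∈ Ico (0:ℝ) 1, 0 ≤ 1 + Jomega ω r := fun r hr =>
    add_nonneg zero_le_one (Jomega_nonneg hpos hr)
  have hX0 : 0 ≤ X := hω.integral_nonneg (by norm_num) ht.1 ht.2.le
    fun r hr => Real.rpow_nonneg (hbase r hr) q
  set f : ℂ → ℂ := {ζ : ℂ | t ≤ ‖ζ‖}.indicator fun _ => 1 with hf
  have hfm : Measurable f :=
    measurable_const.indicator (measurableSet_le measurable_const measurable_norm)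
  have hfn : LpqNormE ω p q f ≤ ENNReal.ofReal W ^ (1 / q) :=
    hω.LpqNormE_indicator_annulus_le hp0 hq0 ht0
  have hfin : LpqNormE ω p q f < ⊤ :=
    hfn.trans_lt (ENNReal.rpow_lt_top_of_nonneg (by positivity) ENNReal.ofReal_ne_top)
  have hop := (hbdd f hfm.aestronglyMeasurable hfin).trans (mul_le_mul_right hfn _)
  have hupper : ∫⁻ r in Ioo (0:ℝ) 1,
      (MpEE p r (PomegaPlusL ω f)) ^ q * ENNReal.ofReal (r * ω r) ≤
      ENNReal.ofReal (C ^ q * W) := by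
    have h := ENNReal.rpow_le_rpow hop hq0.le
    rw [LpqNormEE, ← ENNReal.rpow_mul, one_div_mul_cancel hq0.ne', ENNReal.rpow_one,
      ENNReal.mul_rpow_of_nonneg _ _ hq0.le, ← ENNReal.rpow_mul, one_div_mul_cancel hq0.ne',
      ENNReal.rpow_one, ENNReal.ofReal_rpow_of_nonneg hC.le hq0.le,
      ← ENNReal.ofReal_mul (by positivity)] at h
    exact h
  set c : ℝ := (W / (2 * Real.pi * B)) ^ q / 2 with hc
  have hc0 : 0 < c := by positivity
  have hpt : ∀ r ∈ Ioc (1 / 2) t,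
      ENNReal.ofReal c * ‖(1 + Jomega ω r) ^ q * ω r‖ₑ ≤
      (MpEE p r (PomegaPlusL ω f)) ^ q * ENNReal.ofReal (r * ω r) := by
    intro r hr
    have hr0 : r ∈ Ico (0:ℝ) 1 := ⟨by linarith [hr.1], hr.2.trans_lt ht.2⟩
    have hωr := hω.1 r hr0
    have hb := hbase r hr0
    have hS := hω.hardySum_nonneg hpos (sq_nonneg r)
    have hM : ENNReal.ofReal (hardySum ω (r ^ 2) * (W / (2 * Real.pi))) ≤
        MpEE p r (PomegaPlusL ω f) :=
      le_MpEE_of_forall_le hp0 fun θ => hω.le_PomegaPlusL_indicator hpos hr0.1 hr.2 ht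
    refine le_trans ?_ (mul_le_mul_left (ENNReal.rpow_le_rpow hM hq0.le) _)
    rw [Real.enorm_of_nonneg (by positivity), ← ENNReal.ofReal_mul hc0.le,
      ENNReal.ofReal_rpow_of_nonneg (by positivity) hq0.le, ← ENNReal.ofReal_mul (by positivity)]
    refine ENNReal.ofReal_le_ofReal ?_
    calc c * ((1 + Jomega ω r) ^ q * ω r)
        = (W / (2 * Real.pi * B) * (1 + Jomega ω r)) ^ q * (1 / 2 * ω r) := by
          rw [Real.mul_rpow (by positivity) hb, hc]; ring
      _ ≤ (hardySum ω (r ^ 2) * (W / (2 * Real.pi))) ^ q * (r * ω r) := by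
          have h1 : W / (2 * Real.pi * B) * (1 + Jomega ω r) ≤
              hardySum ω (r ^ 2) * (W / (2 * Real.pi)) := by
            calc _ ≤ W / (2 * Real.pi * B) * (B * hardySum ω (r ^ 2)) := by
                  gcongr; exact hJ r hr0
              _ = _ := by field_simp
          have h2 := hr.1.le
          gcongr
  have hsub : Ioc (1 / 2) t ⊆ Ioo (0:ℝ) 1 := fun r hr =>
    ⟨by linarith [hr.1], hr.2.trans_lt ht.2⟩
  have hXI : ENNReal.ofReal (c * X) ≤ ENNReal.ofReal (C ^ q * W) := by
    rw [ENNReal.ofReal_mul hc0.le]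
    calc ENNReal.ofReal c * ENNReal.ofReal X
        ≤ ENNReal.ofReal c * ∫⁻ r in Ioc (1 / 2) t, ‖(1 + Jomega ω r) ^ q * ω r‖ₑ := by
          rw [hX, intervalIntegral.integral_of_le ht.1]
          gcongr
          exact (Real.ofReal_le_enorm _).trans (enorm_integral_le_lintegral_enorm _)
      _ = ∫⁻ r in Ioc (1 / 2) t, ENNReal.ofReal c * ‖(1 + Jomega ω r) ^ q * ω r‖ₑ :=
          (lintegral_const_mul' _ _ ENNReal.ofReal_ne_top).symm
      _ ≤ _ := setLIntegral_mono' measurableSet_Ioc hpt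
      _ ≤ _ := lintegral_mono_set hsub
      _ ≤ _ := hupper
  rw [ENNReal.ofReal_le_ofReal_iff (by positivity)] at hXI
  have hWq : W ^ q = W ^ (q - 1) * W := by
    rw [← Real.rpow_add_one hW.ne', sub_add_cancel]
  have hmain : X * W ^ (q - 1) ≤ 2 * (2 * Real.pi * B * C) ^ q := by
    rw [hc, Real.div_rpow hW.le (by positivity), hWq] at hXI
    have hBq : 0 < (2 * Real.pi * B) ^ q := by positivity
    rw [Real.mul_rpow (by positivity) hC.le]
    refine le_of_mul_le_mul_right ?_ hW
    calc X * W ^ (q - 1) * W = (2 * (2 * Real.pi * B) ^ q) *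
          (W ^ (q - 1) * W / (2 * Real.pi * B) ^ q / 2 * X) := by field_simp
      _ ≤ (2 * (2 * Real.pi * B) ^ q) * (C ^ q * W) := by gcongr
      _ = _ := by ring
  have hexp : 1 / q' = (q - 1) * (1 / q) := by
    rw [hq', one_div_div]; ring
  rw [hexp, Real.rpow_mul hW.le, ← Real.mul_rpow hX0 (by positivity)]
  exact Real.rpow_le_rpow (by positivity) hmain (by positivity)
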